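/- Let n ≥ 1, h > 0, Y ∈ ℂⁿ, and let F : ℂⁿ → ℂ be bounded and measurable. Then the function G : ℂⁿ → ℂ defined by G(X) = ∫_{ℂⁿ} F(Z) · exp( (1/h)( Σ_j X_j conj(Z_j) + Σ_j conj(Y_j) Z_j ) ) dγ_{h/2}(Z) is well defined (the integrand is integrable for every X) and G is an entire function of X, i.e. complex analytic on all of ℂⁿ. -/

import Mathlib

open MeasureTheory ProbabilityTheory Complex

/-- The Gaussian measure on `ℂ` whose real and imaginary parts are independent
real Gaussians of mean `0` and variance `t`. -/
noncomputable def gaussC (t : ℝ) : Measure ℂ :=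
  ((gaussianReal 0 t.toNNReal).prod (gaussianReal 0 t.toNNReal)).map
    (fun p => (p.1 : ℂ) + (p.2 : ℂ) * Complex.I)

/-- The Gaussian measure `γ_t` on `ℂⁿ`. -/
noncomputable def gaussCn (n : ℕ) (t : ℝ) : Measure (Fin n → ℂ) :=
  Measure.pi fun _ => gaussC t

open NormedSpace in
lemma aux_norm {V : Type*} [NormedAddCommGroup V] [NormedSpace ℂ V] (k : ℕ) (l : V →L[ℂ] ℂ) :
    ‖(expSeries ℂ ℂ k).compContinuousLinearMap (fun _ => l)‖ ≤ ‖l‖ ^ k / k.factorial := by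
  refine (ContinuousMultilinearMap.norm_compContinuousLinearMap_le _ _).trans ?_
  simp only [expSeries, norm_smul, ContinuousMultilinearMap.norm_mkPiAlgebraFin, Finset.prod_const,
    Finset.card_univ, Fintype.card_fin, norm_inv, mul_one]
  rw [div_eq_inv_mul]
  simp

open NormedSpace in
lemma aux_analytic {α V : Type*} [MeasurableSpace α] (μ : Measure α)
    [NormedAddCommGroup V] [NormedSpace ℂ V]
    (f : α → ℂ) (L : α → (V →L[ℂ] ℂ)) (hf : AEStronglyMeasurable f μ)
    (hL : AEStronglyMeasurable L μ)
    (H : Integrable (fun a => ‖f a‖ * Real.exp ‖L a‖) μ) :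
    AnalyticAt ℂ (fun x : V => ∫ a, f a * Complex.exp (L a x) ∂μ) 0 := by
  let M : (k : ℕ) → (V →L[ℂ] ℂ) → ContinuousMultilinearMap ℂ (fun _ : Fin k => V) ℂ :=
    fun k l => (expSeries ℂ ℂ k).compContinuousLinearMap (fun _ => l)
  have hMc : ∀ k, Continuous (M k) := fun k =>
    (ContinuousMultilinearMap.compContinuousLinearMapLRight (𝕜 := ℂ) (E := fun _ : Fin k => V)
      (expSeries ℂ ℂ k)).cont.comp (continuous_pi fun _ => continuous_id)
  have hMn : ∀ k a, ‖M k (L a)‖ ≤ ‖L a‖ ^ k / k.factorial := fun k a => aux_norm k (L a)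
  have hMn' : ∀ k a, ‖M k (L a)‖ ≤ Real.exp ‖L a‖ := fun k a =>
    (hMn k a).trans (Real.pow_div_factorial_le_exp _ (norm_nonneg _) k)
  have hint : ∀ k, Integrable (fun a => f a • M k (L a)) μ := by
    intro k
    refine H.mono' (hf.smul ((hMc k).comp_aestronglyMeasurable hL)) (.of_forall fun a => ?_)
    rw [norm_smul]
    gcongr
    exact hMn' k a
  have hMx : ∀ k a x, M k (L a) (fun _ => x) = (L a x) ^ k / k.factorial := by
    intro k a x
    simp only [M, ContinuousMultilinearMap.compContinuousLinearMap_apply]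
    rw [expSeries_apply_eq, smul_eq_mul, div_eq_inv_mul]
  let p : FormalMultilinearSeries ℂ V ℂ := fun k => ∫ a, f a • M k (L a) ∂μ
  refine ⟨p, 1, ?_, one_pos, ?_⟩
  · refine p.le_radius_of_bound (r := 1) (∫ a, ‖f a‖ * Real.exp ‖L a‖ ∂μ) fun k => ?_
    simp only [NNReal.coe_one, one_pow, mul_one]
    refine norm_integral_le_of_norm_le H (.of_forall fun a => ?_)
    rw [norm_smul]
    gcongr
    exact hMn' k a
  · intro y hy
    have hy1 : ‖y‖ ≤ 1 := by
      have : edist y 0 < 1 := hy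
      rw [edist_zero_right] at this
      have h2 := ENNReal.toReal_mono ENNReal.one_ne_top this.le
      simpa using h2
    have hpk : ∀ k, p k (fun _ => y) = ∫ a, f a * ((L a y) ^ k / k.factorial) ∂μ := by
      intro k
      have := (ContinuousMultilinearMap.apply ℂ (fun _ : Fin k => V) ℂ (fun _ => y)).integral_comp_comm (hint k)
      simp only [ContinuousMultilinearMap.apply_apply, ContinuousMultilinearMap.smul_apply, hMx, smul_eq_mul] at this
      exact this.symm
    simp only [zero_add, hpk]
    have hLy : AEStronglyMeasurable (fun a => L a y) μ :=
      (ContinuousLinearMap.apply ℂ ℂ y).continuous.comp_aestronglyMeasurable hL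
    have hs : ∀ a, HasSum (fun k : ℕ => ‖f a‖ * (‖L a‖ ^ k / k.factorial)) (‖f a‖ * Real.exp ‖L a‖) := by
      intro a
      rw [Real.exp_eq_exp_ℝ]
      exact (expSeries_div_hasSum_exp (‖L a‖)).mul_left _
    refine hasSum_integral_of_dominated_convergence
      (fun k a => ‖f a‖ * (‖L a‖ ^ k / k.factorial)) ?_ ?_ ?_ ?_ ?_
    · intro k
      simp only [div_eq_mul_inv]
      exact hf.mul ((hLy.pow k).mul aestronglyMeasurable_const)
    · intro k
      refine .of_forall fun a => ?_
      rw [norm_mul, norm_div, norm_pow, Complex.norm_natCast]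
      gcongr
      exact (L a).le_of_opNorm_le_of_le le_rfl hy1 |>.trans (by simp)
    · exact .of_forall fun a => (hs a).summable
    · simpa only [(hs _).tsum_eq] using H
    · refine .of_forall fun a => ?_
      rw [Complex.exp_eq_exp_ℂ]
      exact (expSeries_div_hasSum_exp (L a y)).mul_left _

instance aux_prob (t : ℝ) : IsProbabilityMeasure (gaussC t) := by
  unfold gaussC
  exact Measure.isProbabilityMeasure_map (by fun_prop)

lemma aux_gaussC (t a : ℝ) (ha : 0 ≤ a) :
    Integrable (fun z : ℂ => Real.exp (a * ‖z‖)) (gaussC t) := by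
  unfold gaussC
  rw [integrable_map_measure (by fun_prop) (by fun_prop)]
  have h1 : Integrable (fun x : ℝ => Real.exp (a * |x|)) (gaussianReal 0 t.toNNReal) :=
    integrable_exp_mul_abs (X := fun x : ℝ => x) (integrable_exp_mul_gaussianReal a)
      (integrable_exp_mul_gaussianReal (-a))
  refine (h1.mul_prod h1).mono' (by fun_prop) (.of_forall fun p => ?_)
  simp only [Function.comp, Real.norm_eq_abs, Real.abs_exp]
  rw [← Real.exp_add, ← mul_add]
  gcongr
  refine (norm_add_le _ _).trans ?_
  simp

lemma aux_gaussCn (n : ℕ) (t a : ℝ) (ha : 0 ≤ a) :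
    Integrable (fun Z : Fin n → ℂ => Real.exp (a * ∑ j, ‖Z j‖)) (gaussCn n t) := by
  unfold gaussCn
  simp only [Finset.mul_sum, Real.exp_sum]
  exact Integrable.fintype_prod (f := fun (_ : Fin n) (z : ℂ) => Real.exp (a * ‖z‖))
    fun _ => aux_gaussC t a ha

/-- For `F : ℂⁿ → ℂ` bounded measurable and `Y ∈ ℂⁿ`, the function
`G(X) = ∫ F(Z)·exp((1/h)(Σ_j X_j conj Z_j + Σ_j conj Y_j Z_j)) dγ_{h/2}(Z)`
is well defined (the integrand is integrable for every `X`) and is an entire function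
of `X`. -/
theorem bisymbol_integral_entire
    (n : ℕ) (hn : 1 ≤ n) (h : ℝ) (hh : 0 < h) (Y : Fin n → ℂ)
    (F : (Fin n → ℂ) → ℂ) (hFm : Measurable F) (C : ℝ) (hFb : ∀ Z, ‖F Z‖ ≤ C) :
    (∀ X : Fin n → ℂ, Integrable (fun Z => F Z * Complex.exp ((1 / (h : ℂ)) *
        (∑ j, X j * (starRingEnd ℂ) (Z j) + ∑ j, (starRingEnd ℂ) (Y j) * Z j)))
      (gaussCn n (h / 2)))
    ∧ (∀ X : Fin n → ℂ, AnalyticAt ℂ (fun X' : Fin n → ℂ =>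
        ∫ Z, F Z * Complex.exp ((1 / (h : ℂ)) *
          (∑ j, X' j * (starRingEnd ℂ) (Z j) + ∑ j, (starRingEnd ℂ) (Y j) * Z j))
        ∂(gaussCn n (h / 2))) X) := by
  have hlin : ∀ (X Z : Fin n → ℂ), ‖∑ j, X j * (starRingEnd ℂ) (Z j)‖ ≤ ‖X‖ * ∑ j, ‖Z j‖ := by
    intro X Z
    rw [Finset.mul_sum]
    refine norm_sum_le_of_le _ fun j _ => ?_
    rw [norm_mul, RCLike.norm_conj]
    gcongr
    exact norm_le_pi_norm X j
  have hlin2 : ∀ (Z : Fin n → ℂ), ‖∑ j, (starRingEnd ℂ) (Y j) * Z j‖ ≤ ‖Y‖ * ∑ j, ‖Z j‖ := by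
    intro Z
    rw [Finset.mul_sum]
    refine norm_sum_le_of_le _ fun j _ => ?_
    rw [norm_mul, RCLike.norm_conj]
    gcongr
    exact norm_le_pi_norm Y j
  have hC : 0 ≤ C := (norm_nonneg _).trans (hFb 0)
  have hh' : ‖(1 / (h : ℂ))‖ = 1 / h := by
    rw [norm_div, Complex.norm_real, norm_one, Real.norm_of_nonneg hh.le]
  have hfm : ∀ X : Fin n → ℂ, Measurable (fun Z : Fin n → ℂ => F Z * Complex.exp ((1 / (h : ℂ)) *
        (∑ j, X j * (starRingEnd ℂ) (Z j) + ∑ j, (starRingEnd ℂ) (Y j) * Z j))) := by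
    intro X
    refine hFm.mul (Continuous.measurable ?_)
    have : ∀ j, Continuous (fun Z : Fin n → ℂ => (starRingEnd ℂ) (Z j)) :=
      fun j => Complex.continuous_conj.comp (continuous_apply j)
    fun_prop
  have hfn : ∀ X Z : Fin n → ℂ, ‖F Z * Complex.exp ((1 / (h : ℂ)) *
        (∑ j, X j * (starRingEnd ℂ) (Z j) + ∑ j, (starRingEnd ℂ) (Y j) * Z j))‖
        ≤ C * Real.exp ((1 / h * (‖X‖ + ‖Y‖)) * ∑ j, ‖Z j‖) := by
    intro X Z
    rw [norm_mul]
    gcongr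
    · exact hFb Z
    · refine (Complex.norm_exp_le_exp_norm _).trans ?_
      gcongr
      rw [norm_mul, hh', mul_assoc, add_mul]
      gcongr
      exact norm_add_le_of_le (hlin X Z) (hlin2 Z)
  refine ⟨fun X => ?_, fun X => ?_⟩
  · refine ((aux_gaussCn n (h / 2) (1 / h * (‖X‖ + ‖Y‖)) (by positivity)).const_mul C).mono'
      (hfm X).aestronglyMeasurable (.of_forall (hfn X))
  · let L : (Fin n → ℂ) → ((Fin n → ℂ) →L[ℂ] ℂ) := fun Z =>
      ∑ j, ((1 / (h : ℂ)) * (starRingEnd ℂ) (Z j)) • ContinuousLinearMap.proj (R := ℂ) (φ := fun _ : Fin n => ℂ) j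
    have hLx : ∀ Z x, L Z x = (1 / (h : ℂ)) * ∑ j, x j * (starRingEnd ℂ) (Z j) := by
      intro Z x
      simp only [L, ContinuousLinearMap.sum_apply, ContinuousLinearMap.smul_apply,
        ContinuousLinearMap.proj_apply, smul_eq_mul, Finset.mul_sum]
      exact Finset.sum_congr rfl fun j _ => by ring
    have hLc : Continuous L := by
      refine continuous_finset_sum _ fun j _ => ?_
      exact (continuous_const.mul (Complex.continuous_conj.comp (continuous_apply j))).smul
        continuous_const
    have hLn : ∀ Z, ‖L Z‖ ≤ 1 / h * ∑ j, ‖Z j‖ := by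
      intro Z
      refine ContinuousLinearMap.opNorm_le_bound _ (by positivity) fun x => ?_
      rw [hLx, norm_mul, hh', mul_assoc, mul_comm (∑ j, ‖Z j‖)]
      gcongr
      exact hlin x Z
    have key := aux_analytic (gaussCn n (h / 2)) _ L (hfm X).aestronglyMeasurable
      hLc.aestronglyMeasurable (by
        refine ((aux_gaussCn n (h / 2) (1 / h * (‖X‖ + ‖Y‖) + 1 / h) (by positivity)).const_mul
          C).mono' ?_ (.of_forall fun Z => ?_)
        · exact (hfm X).norm.aestronglyMeasurable.mul
            (Real.continuous_exp.comp hLc.norm).aestronglyMeasurable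
        · rw [norm_mul, norm_norm, Real.norm_of_nonneg (Real.exp_pos _).le, add_mul, Real.exp_add,
            ← mul_assoc]
          gcongr
          · exact hfn X Z
          · exact hLn Z)
    have hsub : AnalyticAt ℂ (fun X' : Fin n → ℂ => X' - X) X := analyticAt_id.sub analyticAt_const
    have h2 := AnalyticAt.comp' (f := fun X' : Fin n → ℂ => X' - X) (x := X)
      (by rw [sub_self]; exact key) hsub
    refine h2.congr (.of_forall fun X' => ?_)
    simp only
    congr 1
    ext Z
    rw [mul_assoc, ← Complex.exp_add, hLx, ← mul_add]
    congr 3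
    simp only [Pi.sub_apply, sub_mul, Finset.sum_sub_distrib]
    ring
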